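/- Let φ: ℝ² → ℝ be a smooth (C⁴) function compactly supported in the open unit disk, and let f = (d⊥)²φ, i.e. f11 = ∂²φ/∂x2², f12 = -∂²φ/∂x1∂x2, f22 = ∂²φ/∂x1². Then for every x ∈ ℝ², φ(x) = (1/(2·u2))·∫_0^∞ Tf(x + s·e2) ds and φ(x) = (1/(2·u2))·∫_0^∞ Mf(x + s·e1) ds. -/

import Mathlib

open MeasureTheory

noncomputable section

/-- Rotation of a vector by 90 degrees: `w⊥ = (-w2, w1)`. -/
def perp (w : ℝ × ℝ) : ℝ × ℝ := (-w.2, w.1)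

/-- Divergent beam transform `X_w h (x) = ∫_0^∞ h(x + t w) dt`. -/
def Xray (w : ℝ × ℝ) (h : ℝ × ℝ → ℝ) (x : ℝ × ℝ) : ℝ :=
  ∫ t in Set.Ioi (0:ℝ), h (x + t • w)

/-- First moment divergent beam transform `X¹_w h (x) = ∫_0^∞ t·h(x + t w) dt`. -/
def Xray1 (w : ℝ × ℝ) (h : ℝ × ℝ → ℝ) (x : ℝ × ℝ) : ℝ :=
  ∫ t in Set.Ioi (0:ℝ), t * h (x + t • w)

/-- Directional derivative `D_w h = w1 ∂h/∂x1 + w2 ∂h/∂x2`. -/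
def Dw (w : ℝ × ℝ) (h : ℝ × ℝ → ℝ) (x : ℝ × ℝ) : ℝ :=
  fderiv ℝ h x w

/-- Partial derivative in the first coordinate. -/
def pdx (h : ℝ × ℝ → ℝ) : ℝ × ℝ → ℝ := Dw (1, 0) h

/-- Partial derivative in the second coordinate. -/
def pdy (h : ℝ × ℝ → ℝ) : ℝ × ℝ → ℝ := Dw (0, 1) h

/-- The open unit disk in ℝ². -/
def unitDisk : Set (ℝ × ℝ) := {x | x.1 ^ 2 + x.2 ^ 2 < 1}

/-- `⟨f, w²⟩ = f11 w1² + 2 f12 w1 w2 + f22 w2²`. -/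
def proj2 (f11 f12 f22 : ℝ × ℝ → ℝ) (w : ℝ × ℝ) (x : ℝ × ℝ) : ℝ :=
  f11 x * w.1 ^ 2 + 2 * f12 x * w.1 * w.2 + f22 x * w.2 ^ 2

/-- `⟨f, w ⊙ w⊥⟩ = -f11 w1 w2 + f12 (w1² - w2²) + f22 w1 w2`. -/
def projMix (f11 f12 f22 : ℝ × ℝ → ℝ) (w : ℝ × ℝ) (x : ℝ × ℝ) : ℝ :=
  -(f11 x) * w.1 * w.2 + f12 x * (w.1 ^ 2 - w.2 ^ 2) + f22 x * w.1 * w.2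

/-- V-line transform of a scalar function. -/
def Vlt (u v : ℝ × ℝ) (h : ℝ × ℝ → ℝ) (x : ℝ × ℝ) : ℝ := Xray u h x + Xray v h x

/-- Longitudinal V-line transform. -/
def Lf (u v : ℝ × ℝ) (f11 f12 f22 : ℝ × ℝ → ℝ) (x : ℝ × ℝ) : ℝ :=
  Xray u (proj2 f11 f12 f22 u) x + Xray v (proj2 f11 f12 f22 v) x

/-- Transverse V-line transform. -/
def Tf (u v : ℝ × ℝ) (f11 f12 f22 : ℝ × ℝ → ℝ) (x : ℝ × ℝ) : ℝ :=
  Xray u (proj2 f11 f12 f22 (perp u)) x + Xray v (proj2 f11 f12 f22 (perp v)) x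

/-- Mixed V-line transform. -/
def Mf (u v : ℝ × ℝ) (f11 f12 f22 : ℝ × ℝ → ℝ) (x : ℝ × ℝ) : ℝ :=
  Xray u (projMix f11 f12 f22 u) x + Xray v (projMix f11 f12 f22 v) x

/-- First moment longitudinal V-line transform. -/
def L1f (u v : ℝ × ℝ) (f11 f12 f22 : ℝ × ℝ → ℝ) (x : ℝ × ℝ) : ℝ :=
  Xray1 u (proj2 f11 f12 f22 u) x + Xray1 v (proj2 f11 f12 f22 v) x

theorem hasCompactSupport_of_tsupport_subset_unitDisk {φ : ℝ × ℝ → ℝ}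
    (h : tsupport φ ⊆ unitDisk) : HasCompactSupport φ := by
  refine HasCompactSupport.of_support_subset_isCompact
    (isCompact_Icc (a := ((-1, -1) : ℝ × ℝ)) (b := (1, 1))) ?_
  intro y hy
  have hy' : y.1 ^ 2 + y.2 ^ 2 < 1 := h (subset_tsupport φ hy)
  refine ⟨⟨?_, ?_⟩, ⟨?_, ?_⟩⟩ <;> dsimp only <;> nlinarith [sq_nonneg y.1, sq_nonneg y.2]

/-- The divergent beam transform in direction `w` inverts `-D_w`. -/
theorem Xray_Dw {g : ℝ × ℝ → ℝ} (hg : ContDiff ℝ 1 g) (hc : HasCompactSupport g)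
    {w : ℝ × ℝ} (hw : w ≠ 0) (x : ℝ × ℝ) : Xray w (Dw w g) x = -g x := by
  have hemb : Topology.IsClosedEmbedding (fun t : ℝ => x + t • w) :=
    (Homeomorph.addLeft x).isClosedEmbedding.comp (isClosedEmbedding_smul_left hw)
  have hd : ContDiff ℝ 1 (fun t : ℝ => g (x + t • w)) := by fun_prop
  have hderiv (t : ℝ) : deriv (fun t : ℝ => g (x + t • w)) t = Dw w g (x + t • w) := by
    have hline : HasDerivAt (fun t : ℝ => x + t • w) w t := by
      simpa using ((hasDerivAt_id t).smul_const w).const_add x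
    exact ((hg.differentiable one_ne_zero _).hasFDerivAt.comp_hasDerivAt t hline).deriv
  have key := HasCompactSupport.integral_Ioi_deriv_eq hd (hc.comp_isClosedEmbedding hemb) 0
  simpa only [Xray, hderiv, zero_smul, add_zero] using key

theorem Dw_eq_pdx_pdy (w : ℝ × ℝ) (h : ℝ × ℝ → ℝ) (x : ℝ × ℝ) :
    Dw w h x = w.1 * pdx h x + w.2 * pdy h x := by
  have hw : w = w.1 • ((1, 0) : ℝ × ℝ) + w.2 • ((0, 1) : ℝ × ℝ) := by ext <;> simp
  conv_lhs => rw [Dw, hw, map_add, map_smul, map_smul]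
  rfl

theorem Dw_Dw {φ : ℝ × ℝ → ℝ} (hφ : ContDiff ℝ 2 φ) (w w' x : ℝ × ℝ) :
    Dw w (Dw w' φ) x = fderiv ℝ (fderiv ℝ φ) x w w' := by
  have hd : DifferentiableAt ℝ (fderiv ℝ φ) x :=
    (hφ.fderiv_right (m := 1) le_rfl).differentiable one_ne_zero x
  change fderiv ℝ (fun y => fderiv ℝ φ y w') x w = _
  rw [fderiv_clm_apply hd (differentiableAt_const w')]
  simp

theorem pdx_pdy_comm {φ : ℝ × ℝ → ℝ} (hφ : ContDiff ℝ 2 φ) (x : ℝ × ℝ) :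
    pdy (pdx φ) x = pdx (pdy φ) x := by
  simp only [pdx, pdy, Dw_Dw hφ]
  exact (hφ.contDiffAt.isSymmSndFDerivAt (by simp)).eq _ _

theorem Dw_Dw_eq_pdx_pdy {φ : ℝ × ℝ → ℝ} (hφ : ContDiff ℝ 2 φ) (w w' x : ℝ × ℝ) :
    Dw w (Dw w' φ) x = w.1 * w'.1 * pdx (pdx φ) x
      + (w.1 * w'.2 + w.2 * w'.1) * pdx (pdy φ) x + w.2 * w'.2 * pdy (pdy φ) x := by
  have hcoord (e : ℝ × ℝ) : Dw e (Dw w' φ) x = w'.1 * Dw e (pdx φ) x + w'.2 * Dw e (pdy φ) x := by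
    have hw : w' = w'.1 • ((1, 0) : ℝ × ℝ) + w'.2 • ((0, 1) : ℝ × ℝ) := by ext <;> simp
    simp only [pdx, pdy, Dw_Dw hφ]
    conv_lhs => rw [hw, map_add, map_smul, map_smul]
    rfl
  rw [hcoord, Dw_eq_pdx_pdy w (pdx φ), Dw_eq_pdx_pdy w (pdy φ), pdx_pdy_comm hφ]
  ring

theorem contDiff_Dw {φ : ℝ × ℝ → ℝ} (hφ : ContDiff ℝ 2 φ) (w : ℝ × ℝ) :
    ContDiff ℝ 1 (Dw w φ) :=
  (hφ.fderiv_right (m := 1) le_rfl).clm_apply contDiff_const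

theorem Xray_const_mul (w : ℝ × ℝ) (c : ℝ) (h : ℝ × ℝ → ℝ) (x : ℝ × ℝ) :
    Xray w (fun y => c * h y) x = c * Xray w h x :=
  integral_const_mul _ _

theorem Xray_proj2_perp {φ : ℝ × ℝ → ℝ} (hφ : ContDiff ℝ 2 φ)
    (hc : HasCompactSupport φ) {w : ℝ × ℝ} (hw : w ≠ 0) (x : ℝ × ℝ) :
    Xray w (proj2 (pdy (pdy φ)) (fun y => -(pdx (pdy φ) y)) (pdx (pdx φ)) (perp w)) x
      = -Dw w φ x := by
  rw [← Xray_Dw (contDiff_Dw hφ w) (hc.fderiv_apply ℝ w) hw]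
  congr 1
  funext y
  simp only [proj2, perp, Dw_Dw_eq_pdx_pdy hφ]
  ring

theorem Xray_projMix {φ : ℝ × ℝ → ℝ} (hφ : ContDiff ℝ 2 φ)
    (hc : HasCompactSupport φ) {w : ℝ × ℝ} (hw : w ≠ 0) (x : ℝ × ℝ) :
    Xray w (projMix (pdy (pdy φ)) (fun y => -(pdx (pdy φ) y)) (pdx (pdx φ)) w) x
      = Dw (perp w) φ x := by
  have h : projMix (pdy (pdy φ)) (fun y => -(pdx (pdy φ) y)) (pdx (pdx φ)) w
      = fun y => (-1) * Dw w (Dw (perp w) φ) y := by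
    funext y
    simp only [projMix, perp, Dw_Dw_eq_pdx_pdy hφ]
    ring
  rw [h, Xray_const_mul, Xray_Dw (contDiff_Dw hφ _) (hc.fderiv_apply ℝ _) hw]
  ring

theorem stmt_1 (u1 u2 : ℝ) (hu1 : 0 < u1) (hu2 : 0 < u2) (huv : u1 ^ 2 + u2 ^ 2 = 1)
    (φ : ℝ × ℝ → ℝ) (hφ : ContDiff ℝ 4 φ) (hφsupp : tsupport φ ⊆ unitDisk)
    (f11 f12 f22 : ℝ × ℝ → ℝ)
    (hf11 : f11 = pdy (pdy φ)) (hf12 : f12 = fun x => -(pdx (pdy φ) x)) (hf22 : f22 = pdx (pdx φ)) :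
    ∀ x : ℝ × ℝ,
      φ x = (1 / (2 * u2)) * Xray (0, 1) (Tf (u1, u2) (-u1, u2) f11 f12 f22) x ∧
      φ x = (1 / (2 * u2)) * Xray (1, 0) (Mf (u1, u2) (-u1, u2) f11 f12 f22) x := by
  subst hf11 hf12 hf22
  have hφ2 : ContDiff ℝ 2 φ := hφ.of_le (by norm_num)
  have hc := hasCompactSupport_of_tsupport_subset_unitDisk hφsupp
  have hu : ((u1, u2) : ℝ × ℝ) ≠ 0 := fun h => hu2.ne' (congrArg Prod.snd h)
  have hv : ((-u1, u2) : ℝ × ℝ) ≠ 0 := fun h => hu2.ne' (congrArg Prod.snd h)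
  have hφ1 : ContDiff ℝ 1 φ := hφ.of_le (by norm_num)
  intro x
  have hT : Tf (u1, u2) (-u1, u2) (pdy (pdy φ)) (fun y => -(pdx (pdy φ) y)) (pdx (pdx φ))
      = fun y => (-(2 * u2)) * Dw (0, 1) φ y := by
    funext y
    rw [Tf, Xray_proj2_perp hφ2 hc hu, Xray_proj2_perp hφ2 hc hv, Dw_eq_pdx_pdy,
      Dw_eq_pdx_pdy (-u1, u2), Dw_eq_pdx_pdy (0, 1)]
    ring
  have hM : Mf (u1, u2) (-u1, u2) (pdy (pdy φ)) (fun y => -(pdx (pdy φ) y)) (pdx (pdx φ))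
      = fun y => (-(2 * u2)) * Dw (1, 0) φ y := by
    funext y
    rw [Mf, Xray_projMix hφ2 hc hu, Xray_projMix hφ2 hc hv, Dw_eq_pdx_pdy,
      Dw_eq_pdx_pdy (perp (-u1, u2)), Dw_eq_pdx_pdy (1, 0)]
    simp only [perp]
    ring
  constructor
  · rw [hT, Xray_const_mul, Xray_Dw hφ1 hc (by simp)]
    field_simp
  · rw [hM, Xray_const_mul, Xray_Dw hφ1 hc (by simp)]
    field_simp
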